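/- Let n ≥ 1 and let Ω₁ and Ω₂ be bounded complete Reinhardt domains in ℂⁿ. Let X, Y be complex Banach spaces, U : X → Y a bounded linear operator, 1 ≤ p < ∞ and λ ≥ ‖U‖. Then B_λ(Ω₂,p,U)/(S(Ω₁,Ω₂)·S(Ω₂,Ω₁)) ≤ B_λ(Ω₁,p,U) ≤ S(Ω₁,Ω₂)·S(Ω₂,Ω₁)·B_λ(Ω₂,p,U). -/

import Mathlib

open scoped ENNReal Pointwise
open Filter

noncomputable section

namespace BohrPaper

/-- The monomial `z^α = z₁^{α₁} ⋯ z_n^{α_n}`. -/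
def mpow {n : ℕ} (z : Fin n → ℂ) (α : Fin n → ℕ) : ℂ := ∏ j, z j ^ α j

/-- A complete Reinhardt domain in `ℂⁿ`: nonempty, open, connected and closed under
componentwise decrease of moduli. -/
def IsCompleteReinhardt {n : ℕ} (Ω : Set (Fin n → ℂ)) : Prop :=
  IsOpen Ω ∧ IsConnected Ω ∧
    ∀ z ∈ Ω, ∀ w : Fin n → ℂ, (∀ j, ‖w j‖ ≤ ‖z j‖) → w ∈ Ω

/-- `S(Ω₁, Ω₂) := inf {s > 0 : Ω₁ ⊆ s·Ω₂}`. -/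
def SRatio {n : ℕ} (Ω₁ Ω₂ : Set (Fin n → ℂ)) : ℝ :=
  sInf {s : ℝ | 0 < s ∧ Ω₁ ⊆ s • Ω₂}

/-- The open unit polydisc `𝔻ⁿ`. -/
def polydisc (n : ℕ) : Set (Fin n → ℂ) := {z | ∀ j, ‖z j‖ < 1}

/-- The sup-norm of `f` over `Ω`. -/
def supNorm {n : ℕ} {E : Type*} [Norm E] (Ω : Set (Fin n → ℂ)) (f : (Fin n → ℂ) → E) : ℝ :=
  ⨆ z ∈ Ω, ‖f z‖

/-- The `ℓ_q`-norm on `ℂⁿ` (`q = ∞` gives the max norm). -/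
def lqNorm (n : ℕ) (q : ℝ≥0∞) (z : Fin n → ℂ) : ℝ :=
  if q = ∞ then ⨆ j, ‖z j‖
  else (∑ j, ‖z j‖ ^ q.toReal) ^ (1 / q.toReal)

/-- The open unit ball of `ℓⁿ_q`. -/
def lqBall (n : ℕ) (q : ℝ≥0∞) : Set (Fin n → ℂ) := {z | lqNorm n q z < 1}

/-- `N` is a norm on `ℂⁿ`. -/
def IsNorm {n : ℕ} (N : (Fin n → ℂ) → ℝ) : Prop :=
  (∀ z, 0 ≤ N z) ∧ (∀ z, N z = 0 → z = 0) ∧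
    (∀ (c : ℂ) (z), N (c • z) = ‖c‖ * N z) ∧ ∀ z w, N (z + w) ≤ N z + N w

/-- The canonical basis of `ℂⁿ` is normalized and 1-unconditional for the norm `N`. -/
def IsNormalized1Unconditional {n : ℕ} (N : (Fin n → ℂ) → ℝ) : Prop :=
  (∀ k, N (fun j => if j = k then 1 else 0) = 1) ∧
    ∀ ε μ : Fin n → ℂ, (∀ j, ‖ε j‖ ≤ 1) → N (fun j => ε j * μ j) ≤ N μ

/-- Open unit ball of the norm `N`. -/
def unitBall {n : ℕ} (N : (Fin n → ℂ) → ℝ) : Set (Fin n → ℂ) := {z | N z < 1}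

/-- Operator norm of the identity map `(ℂⁿ, N₁) → (ℂⁿ, N₂)`. -/
def idNorm {n : ℕ} (N₁ N₂ : (Fin n → ℂ) → ℝ) : ℝ :=
  sInf {c : ℝ | 0 ≤ c ∧ ∀ z, N₂ z ≤ c * N₁ z}

/-- `b_m(Ω) = (inf_{|α| = m} sup_{z ∈ Ω} |z^α|)^{-1/m}`. -/
def bCoef {n : ℕ} (Ω : Set (Fin n → ℂ)) (m : ℕ) : ℝ :=
  (sInf ((fun α : Fin n → ℕ => ⨆ z ∈ Ω, ‖mpow z α‖) ''
      {α : Fin n → ℕ | ∑ j, α j = m})) ^ (-(1 / (m : ℝ)))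

section Holomorphic

variable {n : ℕ} {X : Type*} [NormedAddCommGroup X] [NormedSpace ℂ X]
  {Y : Type*} [NormedAddCommGroup Y] [NormedSpace ℂ Y]

/-- `f` is a bounded holomorphic `X`-valued function on `Ω` with monomial expansion
`f = Σ a_α z^α` converging locally uniformly on `Ω`. -/
def IsBddHolomorphic (Ω : Set (Fin n → ℂ)) (f : (Fin n → ℂ) → X)
    (a : (Fin n → ℕ) → X) : Prop :=
  TendstoLocallyUniformlyOn
    (fun (s : Finset (Fin n → ℕ)) z => ∑ α ∈ s, mpow z α • a α) f atTop Ω ∧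
  BddAbove ((fun z => ‖f z‖) '' Ω)

/-- The left-hand side `Σ_α sup_{z ∈ rΩ} ‖U a_α‖^p |z^α|^p` of the second Bohr inequality
for holomorphic functions, valued in `ℝ≥0∞`. -/
def holBohrSum (Ω : Set (Fin n → ℂ)) (r p : ℝ) (U : X →L[ℂ] Y)
    (a : (Fin n → ℕ) → X) : ℝ≥0∞ :=
  ∑' α : Fin n → ℕ, ⨆ z ∈ r • Ω,
    ENNReal.ofReal (‖U (a α)‖ ^ p * ‖mpow z α‖ ^ p)

/-- The second `λ`-powered Bohr radius `B_λ(Ω, p, U)` for holomorphic functions. -/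
def secondBohrHol (Ω : Set (Fin n → ℂ)) (p lam : ℝ) (U : X →L[ℂ] Y) : ℝ :=
  sSup {r : ℝ | r ∈ Set.Icc (0 : ℝ) 1 ∧
    ∀ (f : (Fin n → ℂ) → X) (a : (Fin n → ℕ) → X), IsBddHolomorphic Ω f a →
      holBohrSum Ω r p U a ≤ ENNReal.ofReal (lam ^ p * supNorm Ω f ^ p)}

/-- The first `λ`-powered Bohr radius `K_λ(Ω, p, U)` for holomorphic functions. -/
def firstBohrHol (Ω : Set (Fin n → ℂ)) (p lam : ℝ) (U : X →L[ℂ] Y) : ℝ :=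
  sSup {r : ℝ | r ∈ Set.Icc (0 : ℝ) 1 ∧
    ∀ (f : (Fin n → ℂ) → X) (a : (Fin n → ℕ) → X), IsBddHolomorphic Ω f a →
      (⨆ z ∈ r • Ω, ∑' α : Fin n → ℕ,
        ENNReal.ofReal (‖U (a α)‖ ^ p * ‖mpow z α‖ ^ p)) ≤
        ENNReal.ofReal (lam ^ p * supNorm Ω f ^ p)}

end Holomorphic

theorem mpow_real_smul {n : ℕ} (c : ℝ) (z : Fin n → ℂ) (α : Fin n → ℕ) :
    mpow (c • z) α = (c : ℂ) ^ (∑ j, α j) * mpow z α := by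
  simp [mpow, mul_pow, Finset.prod_mul_distrib, Finset.prod_pow_eq_pow_sum]

theorem IsCompleteReinhardt.zero_mem {n : ℕ} {Ω : Set (Fin n → ℂ)}
    (h : IsCompleteReinhardt Ω) : (0 : Fin n → ℂ) ∈ Ω := by
  obtain ⟨z, hz⟩ := h.2.1.nonempty
  exact h.2.2 z hz 0 fun j => by simp

theorem SRatio_set_nonempty {n : ℕ} {Ω₁ Ω₂ : Set (Fin n → ℂ)}
    (hR₂ : IsCompleteReinhardt Ω₂) (hb₁ : Bornology.IsBounded Ω₁) :
    {s : ℝ | 0 < s ∧ Ω₁ ⊆ s • Ω₂}.Nonempty := by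
  have hv : Bornology.IsVonNBounded ℝ Ω₁ := (NormedSpace.isVonNBounded_iff ℝ).2 hb₁
  obtain ⟨r, hr, h⟩ := (hv (hR₂.1.mem_nhds hR₂.zero_mem)).exists_pos
  exact ⟨r, hr, h r (le_abs_self r)⟩

theorem one_le_of_subset_smul {n : ℕ} (hn : 1 ≤ n) {Ω : Set (Fin n → ℂ)}
    (hR : IsCompleteReinhardt Ω) (hb : Bornology.IsBounded Ω) {c : ℝ} (hc : 0 < c)
    (h : Ω ⊆ c • Ω) : 1 ≤ c := by
  have : Nonempty (Fin n) := ⟨⟨0, hn⟩⟩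
  obtain ⟨z, hz, hz0⟩ : ∃ z ∈ Ω, z ≠ 0 :=
    (nonempty_of_mem (inter_mem (mem_nhdsWithin_of_mem_nhds (hR.1.mem_nhds hR.zero_mem))
      (self_mem_nhdsWithin : ({0}ᶜ : Set (Fin n → ℂ)) ∈ nhdsWithin 0 {0}ᶜ)))
  obtain ⟨C, hC⟩ := hb.exists_norm_le
  have hbdd : BddAbove (norm '' Ω) := ⟨C, by rintro _ ⟨w, hw, rfl⟩; exact hC w hw⟩
  have hpos : 0 < sSup (norm '' Ω) :=
    (norm_pos_iff.2 hz0).trans_le (le_csSup hbdd ⟨z, hz, rfl⟩)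
  have hle : sSup (norm '' Ω) ≤ c * sSup (norm '' Ω) := by
    refine csSup_le ⟨_, z, hz, rfl⟩ ?_
    rintro _ ⟨w, hw, rfl⟩
    obtain ⟨v, hv, rfl⟩ := h hw
    simp only [norm_smul, Real.norm_of_nonneg hc.le]
    exact mul_le_mul_of_nonneg_left (le_csSup hbdd ⟨v, hv, rfl⟩) hc.le
  exact one_le_of_le_mul_right₀ hpos hle

theorem supNorm_nonneg {n : ℕ} {E : Type*} [NormedAddCommGroup E] (Ω : Set (Fin n → ℂ))
    (f : (Fin n → ℂ) → E) : 0 ≤ supNorm Ω f :=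
  Real.iSup_nonneg fun _ => Real.iSup_nonneg fun _ => norm_nonneg _

theorem norm_le_supNorm {n : ℕ} {E : Type*} [NormedAddCommGroup E] {Ω : Set (Fin n → ℂ)}
    {f : (Fin n → ℂ) → E} (hf : BddAbove ((fun z => ‖f z‖) '' Ω)) {z : Fin n → ℂ}
    (hz : z ∈ Ω) : ‖f z‖ ≤ supNorm Ω f := by
  obtain ⟨C, hC⟩ := hf
  have hbdd : BddAbove (Set.range fun w => ⨆ _ : w ∈ Ω, ‖f w‖) := by
    refine ⟨max C 0, ?_⟩
    rintro _ ⟨w, rfl⟩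
    exact Real.iSup_le (fun hw => (hC ⟨w, hw, rfl⟩).trans (le_max_left _ _)) (le_max_right _ _)
  have := le_ciSup hbdd z
  simpa [hz, supNorm] using this

theorem supNorm_comp_le {n : ℕ} {E : Type*} [NormedAddCommGroup E] {Ω₁ Ω₂ : Set (Fin n → ℂ)}
    {f : (Fin n → ℂ) → E} (hf : BddAbove ((fun z => ‖f z‖) '' Ω₁))
    {φ : (Fin n → ℂ) → (Fin n → ℂ)} (hφ : Set.MapsTo φ Ω₂ Ω₁) :
    supNorm Ω₂ (f ∘ φ) ≤ supNorm Ω₁ f :=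
  Real.iSup_le (fun _ => Real.iSup_le (fun hz => norm_le_supNorm hf (hφ hz))
    (supNorm_nonneg _ _)) (supNorm_nonneg _ _)

section Comparison

variable {n : ℕ} {X : Type*} [NormedAddCommGroup X] [NormedSpace ℂ X]
  {Y : Type*} [NormedAddCommGroup Y] [NormedSpace ℂ Y]

theorem IsBddHolomorphic.comp_smul {Ω₁ Ω₂ : Set (Fin n → ℂ)} {f : (Fin n → ℂ) → X}
    {a : (Fin n → ℕ) → X} (h : IsBddHolomorphic Ω₁ f a) {c : ℝ}
    (hc : Set.MapsTo (fun z : Fin n → ℂ => c • z) Ω₂ Ω₁) :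
    IsBddHolomorphic Ω₂ (f ∘ fun z => c • z) fun α => (c : ℂ) ^ (∑ j, α j) • a α := by
  refine ⟨?_, h.2.mono ?_⟩
  · have h' := h.1.comp _ hc (by fun_prop)
    refine h'.congr fun s z _ => Finset.sum_congr rfl fun α _ => ?_
    rw [mpow_real_smul, smul_smul, mul_comm]
  · rintro _ ⟨z, hz, rfl⟩
    exact ⟨_, hc hz, rfl⟩

/-- Rescaling: an admissible radius `r` for `Ω₂` gives the admissible radius `r / (s * t)`
for `Ω₁`. -/
theorem le_mul_secondBohrHol (hn : 1 ≤ n) {Ω₁ Ω₂ : Set (Fin n → ℂ)}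
    (hR₁ : IsCompleteReinhardt Ω₁) (hb₁ : Bornology.IsBounded Ω₁) (U : X →L[ℂ] Y)
    {p lam s t r : ℝ} (hp : 1 ≤ p) (hlam : 0 ≤ lam) (hs : 0 < s) (ht : 0 < t)
    (hs' : Ω₁ ⊆ s • Ω₂) (ht' : Ω₂ ⊆ t • Ω₁) (hr : r ∈ Set.Icc (0 : ℝ) 1)
    (hB : ∀ (f : (Fin n → ℂ) → X) (a : (Fin n → ℕ) → X), IsBddHolomorphic Ω₂ f a →
      holBohrSum Ω₂ r p U a ≤ ENNReal.ofReal (lam ^ p * supNorm Ω₂ f ^ p)) :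
    r ≤ s * (t * secondBohrHol Ω₁ p lam U) := by
  have hst : 0 < s * t := mul_pos hs ht
  have hst1 : 1 ≤ s * t := one_le_of_subset_smul hn hR₁ hb₁ hst <| by
    rw [mul_smul]
    exact hs'.trans (Set.smul_set_mono ht')
  rw [← mul_assoc, ← div_le_iff₀' hst]
  refine le_csSup ⟨1, fun x hx => hx.1.2⟩
    ⟨⟨div_nonneg hr.1 hst.le, (div_le_one hst).2 (hr.2.trans hst1)⟩, fun f a hf => ?_⟩
  have hmap : Set.MapsTo (fun z : Fin n → ℂ => t⁻¹ • z) Ω₂ Ω₁ := fun z hz => by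
    rw [← Set.mem_smul_set_iff_inv_smul_mem₀ ht.ne']
    exact ht' hz
  have hp0 : 0 ≤ p := zero_le_one.trans hp
  refine le_trans ?_ ((hB _ _ (hf.comp_smul hmap)).trans (ENNReal.ofReal_le_ofReal
    (mul_le_mul_of_nonneg_left (Real.rpow_le_rpow (supNorm_nonneg _ _)
      (supNorm_comp_le hf.2 hmap) hp0) (Real.rpow_nonneg hlam _))))
  refine ENNReal.tsum_le_tsum fun α => iSup₂_le fun z hz => ?_
  obtain ⟨w, hw, rfl⟩ := hz
  obtain ⟨v, hv, rfl⟩ := hs' hw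
  refine le_trans (le_of_eq ?_) (le_iSup₂ (r • v) (Set.smul_mem_smul_set hv))
  have hz : (r / (s * t)) • s • v = t⁻¹ • r • v := by
    rw [smul_smul, smul_smul]
    congr 1
    field_simp
  congr 1
  simp only [hz]
  rw [mpow_real_smul t⁻¹, map_smul, norm_smul, norm_mul,
    Real.mul_rpow (norm_nonneg _) (norm_nonneg _), Real.mul_rpow (norm_nonneg _) (norm_nonneg _)]
  ring

theorem le_mul_sInf {A : Set ℝ} (hA : A.Nonempty) {b c : ℝ} (hc : 0 ≤ c)
    (h : ∀ x ∈ A, b ≤ x * c) : b ≤ sInf A * c := by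
  rw [mul_comm, ← smul_eq_mul, ← Real.sInf_smul_of_nonneg hc]
  refine le_csInf hA.smul_set ?_
  rintro _ ⟨x, hx, rfl⟩
  simpa [mul_comm] using h x hx

theorem secondBohrHol_nonneg (Ω : Set (Fin n → ℂ)) (p lam : ℝ) (U : X →L[ℂ] Y) :
    0 ≤ secondBohrHol Ω p lam U :=
  Real.sSup_nonneg fun _ hx => hx.1.1

theorem SRatio_nonneg (Ω₁ Ω₂ : Set (Fin n → ℂ)) : 0 ≤ SRatio Ω₁ Ω₂ :=
  Real.sInf_nonneg fun _ hx => hx.1.le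

theorem secondBohrHol_le (hn : 1 ≤ n) {Ω₁ Ω₂ : Set (Fin n → ℂ)}
    (hR₁ : IsCompleteReinhardt Ω₁) (hR₂ : IsCompleteReinhardt Ω₂)
    (hb₁ : Bornology.IsBounded Ω₁) (hb₂ : Bornology.IsBounded Ω₂) (U : X →L[ℂ] Y)
    {p lam : ℝ} (hp : 1 ≤ p) (hlam : 0 ≤ lam) :
    secondBohrHol Ω₂ p lam U ≤ SRatio Ω₁ Ω₂ * SRatio Ω₂ Ω₁ * secondBohrHol Ω₁ p lam U := by
  have hB := secondBohrHol_nonneg Ω₁ p lam U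
  refine Real.sSup_le (fun r hr => ?_)
    (mul_nonneg (mul_nonneg (SRatio_nonneg _ _) (SRatio_nonneg _ _)) hB)
  rw [mul_assoc]
  refine le_mul_sInf (SRatio_set_nonempty hR₂ hb₁) (mul_nonneg (SRatio_nonneg _ _) hB)
    fun s hs => ?_
  rw [mul_left_comm]
  refine le_mul_sInf (SRatio_set_nonempty hR₁ hb₂) (mul_nonneg hs.1.le hB) fun t ht => ?_
  rw [mul_left_comm]
  exact le_mul_secondBohrHol hn hR₁ hb₁ U hp hlam hs.1 ht.1 hs.2 ht.2 hr.1 hr.2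

end Comparison

/-- comparison of second Bohr radii for holomorphic functions on two bounded
complete Reinhardt domains (Lemma 3.5-a). -/
theorem second_bohr_Hol_domain_comparison {n : ℕ} (hn : 1 ≤ n)
    (Ω₁ Ω₂ : Set (Fin n → ℂ))
    (hR₁ : IsCompleteReinhardt Ω₁) (hR₂ : IsCompleteReinhardt Ω₂)
    (hb₁ : Bornology.IsBounded Ω₁) (hb₂ : Bornology.IsBounded Ω₂)
    {X : Type*} [NormedAddCommGroup X] [NormedSpace ℂ X] [CompleteSpace X]
    {Y : Type*} [NormedAddCommGroup Y] [NormedSpace ℂ Y] [CompleteSpace Y]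
    (U : X →L[ℂ] Y) (p lam : ℝ) (hp : 1 ≤ p) (hU : ‖U‖ ≤ lam) :
    secondBohrHol Ω₂ p lam U / (SRatio Ω₁ Ω₂ * SRatio Ω₂ Ω₁) ≤ secondBohrHol Ω₁ p lam U ∧
      secondBohrHol Ω₁ p lam U ≤ SRatio Ω₁ Ω₂ * SRatio Ω₂ Ω₁ * secondBohrHol Ω₂ p lam U := by
  have hlam : 0 ≤ lam := (norm_nonneg U).trans hU
  refine ⟨?_, ?_⟩
  · refine div_le_of_le_mul₀ (mul_nonneg (SRatio_nonneg _ _) (SRatio_nonneg _ _))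
      (secondBohrHol_nonneg _ _ _ _) ?_
    rw [mul_comm]
    exact secondBohrHol_le hn hR₁ hR₂ hb₁ hb₂ U hp hlam
  · rw [mul_comm (SRatio Ω₁ Ω₂)]
    exact secondBohrHol_le hn hR₂ hR₁ hb₂ hb₁ U hp hlam

end BohrPaper
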